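/- Let K be a field of characteristic different from 2, let f(x) ∈ K[x] be a separable polynomial of even degree d ≥ 6 whose Galois group (acting on its d roots) is the full symmetric group S_d, and let L be the splitting field of f over K with roots α₁, …, α_d ∈ L. Assume the discriminant Δ of f does not lie in −K² (i.e. Δ ≠ −c² for all c ∈ K). Then the images modulo (L^×)² of the elements α_j − α_i ∈ L^× for 1 ≤ i < j ≤ d are linearly independent in the 𝔽₂-vector space L^×/(L^×)²; equivalently, for every nonempty subset S of pairs (i,j) with 1 ≤ i < j ≤ d, the product ∏_{(i,j)∈S} (α_j − α_i) is not a square in L. -/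

import Mathlib

open Polynomial

section RootDifferences

variable {d : ℕ} {L : Type} [Field L] {α : Fin d → L}

/-- The product of the differences `α l - α k` over `l ≠ k`. -/
def rootDiffProd (α : Fin d → L) (k : Fin d) : L := ∏ l ∈ Finset.univ.erase k, (α l - α k)

lemma rootDiffProd_ne_zero (hinj : Function.Injective α) (k : Fin d) : rootDiffProd α k ≠ 0 :=
  Finset.prod_ne_zero_iff.2 fun _ hl =>
    sub_ne_zero.2 (hinj.ne (Finset.ne_of_mem_erase hl))

lemma prod_rootDiffProd_sq : ∏ k, rootDiffProd α k ^ 2 = (Matrix.vandermonde α).det ^ 4 := by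
  have hsplit : ∀ k, rootDiffProd α k ^ 2 =
      (∏ l ∈ Finset.Ioi k, (α l - α k) ^ 2) * ∏ l ∈ Finset.Iio k, (α l - α k) ^ 2 := by
    intro k
    rw [rootDiffProd, ← Finset.prod_pow, ← Finset.prod_union]
    · congr 1
      ext l
      simp [eq_comm]
    · exact Finset.disjoint_left.2 fun l h1 h2 =>
        lt_asymm (Finset.mem_Ioi.1 h1) (Finset.mem_Iio.1 h2)
  have hswap : ∏ k, ∏ l ∈ Finset.Iio k, (α l - α k) ^ 2 =
      ∏ k, ∏ l ∈ Finset.Ioi k, (α l - α k) ^ 2 := by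
    rw [Finset.prod_comm' (t' := Finset.univ) (s' := fun k => Finset.Ioi k) (by simp)]
    exact Finset.prod_congr rfl fun _ _ => Finset.prod_congr rfl fun _ _ => by ring
  simp_rw [hsplit]
  rw [Finset.prod_mul_distrib, hswap, Matrix.det_vandermonde]
  simp_rw [Finset.prod_pow]
  ring

/-- The squared difference of the roots labelled by the endpoints of an edge. -/
def sqDiff (α : Fin d → L) : Sym2 (Fin d) → L :=
  Sym2.lift ⟨fun i j => (α i - α j) ^ 2, fun _ _ => by ring⟩

lemma sqDiff_mk (i j : Fin d) : sqDiff α s(i, j) = (α i - α j) ^ 2 := rfl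

lemma sqDiff_ne_zero (hinj : Function.Injective α) {e : Sym2 (Fin d)} (he : ¬ e.IsDiag) :
    sqDiff α e ≠ 0 := by
  induction e using Sym2.ind with
  | _ i j => exact pow_ne_zero _ (sub_ne_zero.2 (hinj.ne he))

lemma isSquare_sqDiff (e : Sym2 (Fin d)) : IsSquare (sqDiff α e) := by
  induction e using Sym2.ind with
  | _ i j => exact ⟨α i - α j, sq _⟩

/-- Edge sets whose product of differences is a square up to sign are closed under symmetric
difference. -/
lemma exists_prod_symmDiff_sqDiff_eq_pow_four (hinj : Function.Injective α)
    {T T' : Finset (Sym2 (Fin d))} (hT : ∀ e ∈ T, ¬ e.IsDiag) {x y : L}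
    (hx : ∏ e ∈ T, sqDiff α e = x ^ 4) (hy : ∏ e ∈ T', sqDiff α e = y ^ 4) :
    ∃ z, ∏ e ∈ symmDiff T T', sqDiff α e = z ^ 4 := by
  obtain ⟨w, hw⟩ : IsSquare (∏ e ∈ T ∩ T', sqDiff α e) :=
    Finset.isSquare_prod _ fun e _ => isSquare_sqDiff e
  have hw0 : w ≠ 0 := by
    rintro rfl
    rw [mul_zero, Finset.prod_eq_zero_iff] at hw
    obtain ⟨e, he, h0⟩ := hw
    exact sqDiff_ne_zero hinj (hT e (Finset.mem_of_mem_inter_left he)) h0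
  refine ⟨x * y / w, ?_⟩
  rw [div_pow, mul_pow, ← hx, ← hy, eq_div_iff (pow_ne_zero _ hw0), symmDiff_def,
    Finset.sup_eq_union, Finset.prod_union disjoint_sdiff_sdiff,
    ← Finset.prod_inter_mul_prod_sdiff T T', ← Finset.prod_inter_mul_prod_sdiff T' T,
    Finset.inter_comm T' T, hw]
  ring

end RootDifferences

lemma exists_ne_of_card_lt {n : ℕ} (s : Finset (Fin n)) (h : s.card < n) : ∃ x, x ∉ s := by
  by_contra! hs
  have := Finset.card_le_card (fun x _ => hs x : Finset.univ ⊆ s)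
  simp at this
  omega

section RigidAction

variable {d : ℕ} {L : Type} [Field L] [MulSemiringAction (Equiv.Perm (Fin d)) L] {α : Fin d → L}

/-- Under an action for which the fourth roots of unity are rigid, an involution maps an element
to one of its two sign changes as soon as it preserves its fourth power. -/
lemma smul_sq_eq_of_smul_pow_four_eq
    (hrig : ∀ (σ : Equiv.Perm (Fin d)) (u v : L), u ^ 4 = v ^ 4 → σ • u * v = σ • v * u)
    {σ : Equiv.Perm (Fin d)} (hσ : σ * σ = 1) {β : L} (h : (σ • β) ^ 4 = β ^ 4) :
    (σ • β) ^ 2 = β ^ 2 := by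
  have := hrig σ _ _ h
  rw [← mul_smul, hσ, one_smul] at this
  linear_combination -this

lemma smul_eq_of_pow_four_eq
    (hrig : ∀ (σ : Equiv.Perm (Fin d)) (u v : L), u ^ 4 = v ^ 4 → σ • u * v = σ • v * u)
    {σ : Equiv.Perm (Fin d)} {u v : L} (hv : v ≠ 0) (h : u ^ 4 = v ^ 4) (hσ : σ • v = v) :
    σ • u = u := by
  have := hrig σ u v h
  rw [hσ, mul_comm] at this
  exact mul_left_cancel₀ hv this

lemma smul_eq_neg_of_pow_four_eq
    (hrig : ∀ (σ : Equiv.Perm (Fin d)) (u v : L), u ^ 4 = v ^ 4 → σ • u * v = σ • v * u)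
    {σ : Equiv.Perm (Fin d)} {u v : L} (hv : v ≠ 0) (h : u ^ 4 = v ^ 4) (hσ : σ • v = -v) :
    σ • u = -u := by
  have := hrig σ u v h
  rw [hσ] at this
  exact mul_right_cancel₀ hv (by linear_combination this)

/-- The action of a permutation on the Vandermonde determinant. -/
lemma smul_det_vandermonde (hα : ∀ (σ : Equiv.Perm (Fin d)) i, σ • α i = α (σ i))
    (σ : Equiv.Perm (Fin d)) :
    σ • (Matrix.vandermonde α).det = (Equiv.Perm.sign σ : ℤ) * (Matrix.vandermonde α).det := by
  have h := RingHom.map_det (MulSemiringAction.toRingHom (Equiv.Perm (Fin d)) L σ)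
    (Matrix.vandermonde α)
  rw [← Matrix.det_permute]
  rw [MulSemiringAction.toRingHom_apply] at h
  rw [h]
  congr 1
  ext i j
  simp [Matrix.vandermonde_apply, hα, smul_pow']

lemma swap_smul_det_vandermonde (hα : ∀ (σ : Equiv.Perm (Fin d)) i, σ • α i = α (σ i))
    {a b : Fin d} (hab : a ≠ b) :
    Equiv.swap a b • (Matrix.vandermonde α).det = -(Matrix.vandermonde α).det := by
  rw [smul_det_vandermonde hα, Equiv.Perm.sign_swap hab]; simp

/-- The Vandermonde determinant is not a square up to sign. -/
lemma det_vandermonde_sq_ne_pow_four (h2 : (2 : L) ≠ 0) (hinj : Function.Injective α)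
    (hα : ∀ (σ : Equiv.Perm (Fin d)) i, σ • α i = α (σ i))
    (hrig : ∀ (σ : Equiv.Perm (Fin d)) (u v : L), u ^ 4 = v ^ 4 → σ • u * v = σ • v * u)
    {a b : Fin d} (hab : a ≠ b) (β : L) : (Matrix.vandermonde α).det ^ 2 ≠ β ^ 4 := by
  intro h
  have hV : (Matrix.vandermonde α).det ≠ 0 := Matrix.det_vandermonde_ne_zero_iff.2 hinj
  have hg := swap_smul_det_vandermonde hα hab
  have h4 : (Equiv.swap a b • β) ^ 4 = β ^ 4 := by
    rw [← smul_pow', ← h, smul_pow', hg]; ring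
  have hsq := smul_sq_eq_of_smul_pow_four_eq hrig (Equiv.swap_mul_self a b) h4
  rw [← smul_pow'] at hsq
  have hβ : β ^ 2 = (Matrix.vandermonde α).det ∨ β ^ 2 = -(Matrix.vandermonde α).det :=
    sq_eq_sq_iff_eq_or_eq_neg.1 (by rw [h]; ring)
  have : (2 : L) * (Matrix.vandermonde α).det = 0 := by
    rcases hβ with hβ | hβ <;> rw [hβ] at hsq
    · rw [hg] at hsq; linear_combination -hsq
    · rw [smul_neg, hg] at hsq; linear_combination hsq
  exact (mul_ne_zero h2 hV) this

/-- If the product of the differences along the `4`-cycle `a, c, b, e` is a square up to sign,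
then its square root is fixed by the transposition of `a` and `b`. -/
lemma swap_smul_eq_self_of_four_cycle (h2 : (2 : L) ≠ 0) (hinj : Function.Injective α)
    (hα : ∀ (σ : Equiv.Perm (Fin d)) i, σ • α i = α (σ i))
    (hrig : ∀ (σ : Equiv.Perm (Fin d)) (u v : L), u ^ 4 = v ^ 4 → σ • u * v = σ • v * u)
    {a b c e x : Fin d} (hac : a ≠ c) (hae : a ≠ e) (hax : a ≠ x) (hbc : b ≠ c)
    (hbe : b ≠ e) (hbx : b ≠ x) (hce : c ≠ e) (hcx : c ≠ x) (hex : e ≠ x) {β : L} (hβ : β ≠ 0)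
    (h : (((α c - α a) * (α c - α b)) * ((α e - α a) * (α e - α b))) ^ 2 = β ^ 4) :
    Equiv.swap a b • β = β := by
  have hne : ∀ {i j}, i ≠ j → α j - α i ≠ 0 := fun h => sub_ne_zero.2 (hinj.ne h.symm)
  have hact : ∀ σ : Equiv.Perm (Fin d), (σ • β) ^ 4 = (((α (σ c) - α (σ a)) *
      (α (σ c) - α (σ b))) * ((α (σ e) - α (σ a)) * (α (σ e) - α (σ b)))) ^ 2 := by
    intro σ
    rw [← smul_pow', ← h]
    simp only [smul_pow', smul_mul', smul_sub, hα]
  set g := Equiv.swap a b with hgdef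
  have hga : g a = b := Equiv.swap_apply_left a b
  have hgb : g b = a := Equiv.swap_apply_right a b
  have hgc : g c = c := Equiv.swap_apply_of_ne_of_ne hac.symm hbc.symm
  have hge : g e = e := Equiv.swap_apply_of_ne_of_ne hae.symm hbe.symm
  have hgx : g x = x := Equiv.swap_apply_of_ne_of_ne hax.symm hbx.symm
  have hsign : (g • β) ^ 2 = β ^ 2 := by
    apply smul_sq_eq_of_smul_pow_four_eq hrig (Equiv.swap_mul_self a b)
    rw [hact, hga, hgb, hgc, hge, ← h]; ring
  refine (sq_eq_sq_iff_eq_or_eq_neg.1 hsign).resolve_right fun h1 => ?_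
  set β₂ := Equiv.swap e x • β with hβ₂
  set β₃ := Equiv.swap c x • β with hβ₃
  have h₂ : β₂ ^ 4 = _ := hact _
  have h₃ : β₃ ^ 4 = _ := hact _
  simp only [Equiv.swap_apply_left, Equiv.swap_apply_of_ne_of_ne hae hax,
    Equiv.swap_apply_of_ne_of_ne hbe hbx, Equiv.swap_apply_of_ne_of_ne hce hcx] at h₂
  simp only [Equiv.swap_apply_left, Equiv.swap_apply_of_ne_of_ne hac hax,
    Equiv.swap_apply_of_ne_of_ne hbc hbx, Equiv.swap_apply_of_ne_of_ne hce.symm hex] at h₃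
  have hcomm : ∀ {p q : Fin d}, a ≠ p → a ≠ q → b ≠ p → b ≠ q →
      g • (Equiv.swap p q • β) = -(Equiv.swap p q • β) := by
    intro p q h1' h2' h3' h4'
    rw [← mul_smul, hgdef, Equiv.swap_mul_eq_mul_swap, Equiv.swap_inv,
      Equiv.swap_apply_of_ne_of_ne h1' h2', Equiv.swap_apply_of_ne_of_ne h3' h4', mul_smul,
      ← hgdef, h1, smul_neg]
  have hu := smul_eq_of_pow_four_eq hrig (σ := g) (u := β * β₂ * β₃)
    (v := (α c - α a) * (α c - α b) * ((α e - α a) * (α e - α b)) *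
      ((α x - α a) * (α x - α b)))
    (by simp [hne hac, hne hae, hne hax, hne hbc, hne hbe, hne hbx])
    (by
      rw [mul_pow, mul_pow, h₂, h₃, ← h]
      generalize α c - α a = y₁, α c - α b = y₂, α e - α a = y₃, α e - α b = y₄,
        α x - α a = y₅, α x - α b = y₆
      ring)
    (by
      simp only [smul_mul', smul_sub, hα, hga, hgb, hgc, hge, hgx]
      generalize α c - α a = y₁, α c - α b = y₂, α e - α a = y₃, α e - α b = y₄,
        α x - α a = y₅, α x - α b = y₆
      ring)
  rw [smul_mul', smul_mul', h1, hcomm hae hax hbe hbx, hcomm hac hax hbc hbx] at hu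
  have hz : 2 * (β * β₂ * β₃) = 0 := by linear_combination -hu
  refine mul_ne_zero h2 (mul_ne_zero (mul_ne_zero hβ ?_) ?_) hz
  · rwa [hβ₂, Ne, smul_eq_zero_iff_eq]
  · rwa [hβ₃, Ne, smul_eq_zero_iff_eq]

/-- The product of the differences along the edges of a `4`-cycle is not a square up to sign. -/
lemma four_cycle_sq_ne_pow_four (h2 : (2 : L) ≠ 0) (hinj : Function.Injective α)
    (hα : ∀ (σ : Equiv.Perm (Fin d)) i, σ • α i = α (σ i))
    (hrig : ∀ (σ : Equiv.Perm (Fin d)) (u v : L), u ^ 4 = v ^ 4 → σ • u * v = σ • v * u)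
    {a b c e x : Fin d} (hab : a ≠ b) (hac : a ≠ c) (hae : a ≠ e) (hax : a ≠ x) (hbc : b ≠ c)
    (hbe : b ≠ e) (hbx : b ≠ x) (hce : c ≠ e) (hcx : c ≠ x) (hex : e ≠ x) (β : L) :
    (((α c - α a) * (α c - α b)) * ((α e - α a) * (α e - α b))) ^ 2 ≠ β ^ 4 := by
  intro h
  have hne : ∀ {i j}, i ≠ j → α j - α i ≠ 0 := fun h => sub_ne_zero.2 (hinj.ne h.symm)
  have hβ : β ≠ 0 := by
    rintro rfl
    simp [hne hac, hne hae, hne hbc, hne hbe] at h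
  have hfix := swap_smul_eq_self_of_four_cycle h2 hinj hα hrig hac hae hax hbc hbe hbx hce hcx
    hex hβ h
  have hact : ∀ σ : Equiv.Perm (Fin d), (σ • β) ^ 4 = (((α (σ c) - α (σ a)) *
      (α (σ c) - α (σ b))) * ((α (σ e) - α (σ a)) * (α (σ e) - α (σ b)))) ^ 2 := by
    intro σ
    rw [← smul_pow', ← h]
    simp only [smul_pow', smul_mul', smul_sub, hα]
  set g := Equiv.swap a b with hgdef
  have hga : g a = b := Equiv.swap_apply_left a b
  have hgb : g b = a := Equiv.swap_apply_right a b
  have hgc : g c = c := Equiv.swap_apply_of_ne_of_ne hac.symm hbc.symm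
  have hge : g e = e := Equiv.swap_apply_of_ne_of_ne hae.symm hbe.symm
  set β₂ := Equiv.swap b c • β with hβ₂
  set β₃ := Equiv.swap b e • β with hβ₃
  have h₂ : β₂ ^ 4 = _ := hact _
  have h₃ : β₃ ^ 4 = _ := hact _
  have h₄ : (g • β₂) ^ 4 = _ := (congrArg (· ^ 4) (mul_smul _ _ _).symm).trans (hact _)
  simp only [Equiv.Perm.mul_apply, Equiv.swap_apply_left, Equiv.swap_apply_right,
    Equiv.swap_apply_of_ne_of_ne hab hac, Equiv.swap_apply_of_ne_of_ne hbe.symm hce.symm,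
    hga, hgb, hgc, hge] at h₂ h₄
  simp only [Equiv.swap_apply_left, Equiv.swap_apply_right,
    Equiv.swap_apply_of_ne_of_ne hab hae, Equiv.swap_apply_of_ne_of_ne hbc.symm hce] at h₃
  have r₁ : α a - α b = -(α b - α a) := (neg_sub _ _).symm
  have r₂ : α a - α c = -(α c - α a) := (neg_sub _ _).symm
  have r₃ : α b - α c = -(α c - α b) := (neg_sub _ _).symm
  have r₄ : α b - α e = -(α e - α b) := (neg_sub _ _).symm
  have r₅ : α c - α e = -(α e - α c) := (neg_sub _ _).symm
  simp only [r₁, r₂, r₃, r₄, r₅] at h₂ h₃ h₄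
  have h₅ := hrig g (g • β₂) β₃ (by
    rw [h₃, h₄]
    generalize α b - α a = y₀, α c - α a = y₁, α c - α b = y₂, α e - α a = y₃, α e - α b = y₄,
      α e - α c = y₅
    ring)
  rw [← mul_smul, Equiv.swap_mul_self a b, one_smul] at h₅
  have hu := smul_eq_neg_of_pow_four_eq hrig (σ := g) (u := β * (β₂ * β₃))
    (v := (α b - α a) * (α c - α a) * (α e - α a) * (α c - α b) * (α e - α b) * (α e - α c))
    (by simp [hne hab, hne hac, hne hae, hne hbc, hne hbe, hne hce])
    (by
      rw [mul_pow, mul_pow, h₂, h₃, ← h]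
      generalize α b - α a = y₀, α c - α a = y₁, α c - α b = y₂, α e - α a = y₃,
        α e - α b = y₄, α e - α c = y₅
      ring)
    (by
      simp only [smul_mul', smul_sub, hα, hga, hgb, hgc, hge, r₁]
      generalize α b - α a = y₀, α c - α a = y₁, α c - α b = y₂, α e - α a = y₃,
        α e - α b = y₄, α e - α c = y₅
      ring)
  rw [smul_mul', smul_mul', hfix, mul_comm (g • β₂), ← h₅] at hu
  have hz : 2 * (β * (β₂ * β₃)) = 0 := by linear_combination hu
  refine mul_ne_zero h2 (mul_ne_zero hβ (mul_ne_zero ?_ ?_)) hz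
  · rwa [hβ₂, Ne, smul_eq_zero_iff_eq]
  · rwa [hβ₃, Ne, smul_eq_zero_iff_eq]

lemma smul_rootDiffProd (hα : ∀ (σ : Equiv.Perm (Fin d)) i, σ • α i = α (σ i))
    (σ : Equiv.Perm (Fin d)) (k : Fin d) :
    σ • rootDiffProd α k = rootDiffProd α (σ k) := by
  unfold rootDiffProd
  rw [Finset.smul_prod']
  refine Finset.prod_equiv σ (by simp) ?_
  intro i _
  rw [smul_sub, hα, hα]

/-- If `rootDiffProd α a * rootDiffProd α b` is a square up to sign, then its square root is fixed
by the transpositions disjoint from `a` and `b`. -/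
lemma swap_smul_eq_self_of_rootDiffProd (h2 : (2 : L) ≠ 0) (hinj : Function.Injective α)
    (hα : ∀ (σ : Equiv.Perm (Fin d)) i, σ • α i = α (σ i))
    (hrig : ∀ (σ : Equiv.Perm (Fin d)) (u v : L), u ^ 4 = v ^ 4 → σ • u * v = σ • v * u)
    {a b p q x : Fin d} (hap : a ≠ p) (haq : a ≠ q) (hbp : b ≠ p) (hbq : b ≠ q)
    (hax : a ≠ x) (hbx : b ≠ x) (hpx : p ≠ x) (hqx : q ≠ x) (hab : a ≠ b)
    {β : L} (hβ : β ≠ 0) (h : (rootDiffProd α a * rootDiffProd α b) ^ 2 = β ^ 4) :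
    Equiv.swap p q • β = β := by
  have hact : ∀ σ : Equiv.Perm (Fin d),
      (σ • β) ^ 4 = (rootDiffProd α (σ a) * rootDiffProd α (σ b)) ^ 2 := by
    intro σ
    rw [← smul_pow', ← h]
    simp only [smul_pow', smul_mul', smul_rootDiffProd hα]
  set g := Equiv.swap p q with hgdef
  have hga : g a = a := Equiv.swap_apply_of_ne_of_ne hap haq
  have hgb : g b = b := Equiv.swap_apply_of_ne_of_ne hbp hbq
  have hgx : g x = x := Equiv.swap_apply_of_ne_of_ne hpx.symm hqx.symm
  have hsign : (g • β) ^ 2 = β ^ 2 := by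
    apply smul_sq_eq_of_smul_pow_four_eq hrig (Equiv.swap_mul_self p q)
    rw [hact, hga, hgb, ← h]
  refine (sq_eq_sq_iff_eq_or_eq_neg.1 hsign).resolve_right fun h1 => ?_
  set β₂ := Equiv.swap b x • β with hβ₂
  set β₃ := Equiv.swap a x • β with hβ₃
  have h₂ : β₂ ^ 4 = _ := hact _
  have h₃ : β₃ ^ 4 = _ := hact _
  rw [Equiv.swap_apply_left, Equiv.swap_apply_of_ne_of_ne hab hax] at h₂
  rw [Equiv.swap_apply_left, Equiv.swap_apply_of_ne_of_ne hab.symm hbx] at h₃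
  have hcomm : ∀ {r s : Fin d}, g r = r → g s = s →
      g • (Equiv.swap r s • β) = -(Equiv.swap r s • β) := by
    intro r s hr hs
    rw [← mul_smul, Equiv.mul_swap_eq_swap_mul, hr, hs, mul_smul, h1, smul_neg]
  have hu := smul_eq_of_pow_four_eq hrig (σ := g) (u := β * β₂ * β₃)
    (v := rootDiffProd α a * rootDiffProd α b * rootDiffProd α x)
    (by simp [rootDiffProd_ne_zero hinj])
    (by rw [mul_pow, mul_pow, h₂, h₃, ← h]; ring)
    (by simp only [smul_mul', smul_rootDiffProd hα, hga, hgb, hgx])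
  rw [smul_mul', smul_mul', h1, hcomm hgb hgx, hcomm hga hgx] at hu
  have hz : 2 * (β * β₂ * β₃) = 0 := by linear_combination -hu
  refine mul_ne_zero h2 (mul_ne_zero (mul_ne_zero hβ ?_) ?_) hz
  · rwa [hβ₂, Ne, smul_eq_zero_iff_eq]
  · rwa [hβ₃, Ne, smul_eq_zero_iff_eq]

/-- For even `d`, the products `rootDiffProd α a * rootDiffProd α b` are not squares up to sign. -/
lemma rootDiffProd_mul_sq_ne_pow_four (h2 : (2 : L) ≠ 0) (hd6 : 6 ≤ d) (hd : Even d)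
    (hinj : Function.Injective α)
    (hα : ∀ (σ : Equiv.Perm (Fin d)) i, σ • α i = α (σ i))
    (hrig : ∀ (σ : Equiv.Perm (Fin d)) (u v : L), u ^ 4 = v ^ 4 → σ • u * v = σ • v * u)
    {a b : Fin d} (hab : a ≠ b) (β : L) :
    (rootDiffProd α a * rootDiffProd α b) ^ 2 ≠ β ^ 4 := by
  intro h
  have hβ : β ≠ 0 := by
    rintro rfl
    simp [rootDiffProd_ne_zero hinj] at h
  obtain ⟨c, hc⟩ := exists_ne_of_card_lt {a, b} (by
    have := Finset.card_le_two (a := a) (b := b); omega)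
  simp only [Finset.mem_insert, Finset.mem_singleton, not_or] at hc
  obtain ⟨hca, hcb⟩ := hc
  have hfix : ∀ k, k ≠ a → k ≠ b → Equiv.swap k c • β = β := by
    intro k hka hkb
    obtain ⟨x, hx⟩ := exists_ne_of_card_lt {a, b, k, c} (by
      have := Finset.card_le_four (a := a) (b := b) (c := k) (d := c); omega)
    simp only [Finset.mem_insert, Finset.mem_singleton, not_or] at hx
    obtain ⟨hxa, hxb, hxk, hxc⟩ := hx
    exact swap_smul_eq_self_of_rootDiffProd h2 hinj hα hrig (Ne.symm hka) (Ne.symm hca)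
      (Ne.symm hkb) (Ne.symm hcb) (Ne.symm hxa) (Ne.symm hxb) (Ne.symm hxk) (Ne.symm hxc) hab hβ h
  set g := Equiv.swap b c with hg
  have hga : g a = a := Equiv.swap_apply_of_ne_of_ne hab (Ne.symm hca)
  have hperm : ∀ k, k ≠ a → g • (Equiv.swap b k • β) = Equiv.swap b (g k) • β := by
    intro k hka
    by_cases hkb : k = b
    · subst hkb
      rw [hg, Equiv.swap_self, Equiv.swap_apply_left, ← Equiv.Perm.one_def, one_smul]
    by_cases hkc : k = c
    · subst hkc
      rw [hg, ← mul_smul, Equiv.swap_mul_self, Equiv.swap_apply_right, Equiv.swap_self,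
        ← Equiv.Perm.one_def]
    rw [hg, ← mul_smul, Equiv.swap_mul_eq_mul_swap, Equiv.swap_inv, Equiv.swap_apply_left,
      Equiv.swap_apply_of_ne_of_ne hcb (Ne.symm hkc), mul_smul, hfix k hka hkb,
      Equiv.swap_apply_of_ne_of_ne hkb hkc]
  obtain ⟨m, hm⟩ : ∃ m, d = 2 * m + 2 := by
    obtain ⟨r, hr⟩ := hd
    exact ⟨r - 1, by omega⟩
  set u := ∏ k ∈ Finset.univ.erase a, Equiv.swap b k • β with hu
  have hgu : g • u = u := by
    rw [hu, Finset.smul_prod']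
    refine Finset.prod_equiv g ?_ ?_
    · intro k
      simp only [Finset.mem_erase, Finset.mem_univ, and_true]
      rw [← g.injective.ne_iff (x := k), hga]
    · intro k hk
      exact hperm k (Finset.ne_of_mem_erase hk)
  have hu4 : u ^ 4 = (rootDiffProd α a ^ m * (Matrix.vandermonde α).det) ^ 4 := by
    have h1 : u ^ 4 = ∏ k ∈ Finset.univ.erase a, (rootDiffProd α a ^ 2 * rootDiffProd α k ^ 2) := by
      rw [hu, ← Finset.prod_pow]
      refine Finset.prod_congr rfl fun k hk => ?_
      rw [← smul_pow', ← h, smul_pow', smul_mul', smul_rootDiffProd hα, smul_rootDiffProd hα,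
        Equiv.swap_apply_left,
        Equiv.swap_apply_of_ne_of_ne hab (Finset.ne_of_mem_erase hk).symm, mul_pow]
    rw [h1, Finset.prod_mul_distrib, Finset.prod_const, Finset.card_erase_of_mem (Finset.mem_univ _),
      Finset.card_univ, Fintype.card_fin, mul_pow, ← prod_rootDiffProd_sq,
      ← Finset.mul_prod_erase _ _ (Finset.mem_univ a)]
    rw [show d - 1 = 2 * m + 1 by omega]
    ring
  have hne := smul_eq_neg_of_pow_four_eq hrig (σ := g) (mul_ne_zero
    (pow_ne_zero m (rootDiffProd_ne_zero hinj a)) (Matrix.det_vandermonde_ne_zero_iff.2 hinj)) hu4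
    (by rw [smul_mul', smul_pow', smul_rootDiffProd hα, hga,
          swap_smul_det_vandermonde hα (Ne.symm hcb)]; ring)
  rw [hgu] at hne
  have hu0 : u ≠ 0 := Finset.prod_ne_zero_iff.2 fun k _ => by rwa [Ne, smul_eq_zero_iff_eq]
  exact mul_ne_zero h2 hu0 (by linear_combination hne)

lemma smul_sqDiff (hα : ∀ (σ : Equiv.Perm (Fin d)) i, σ • α i = α (σ i))
    (σ : Equiv.Perm (Fin d)) (e : Sym2 (Fin d)) :
    σ • sqDiff α e = sqDiff α (e.map σ) := by
  induction e using Sym2.ind with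
  | _ i j => rw [Sym2.map_mk, sqDiff_mk, sqDiff_mk, smul_pow', smul_sub, hα, hα]

/-- A symmetric irreflexive relation differs from its image under the transposition of `a` and `b`
precisely at the pairs made of `a` or `b` and a third element related to exactly one of them. -/
lemma symm_rel_swap_xor_iff {ι : Type*} [DecidableEq ι] {r : ι → ι → Prop}
    (hr : ∀ i j, r i j ↔ r j i) (hirr : ∀ i, ¬ r i i) {a b : ι} (hab : a ≠ b) (i j : ι) :
    (r i j ∧ ¬ r (if i = a then b else if i = b then a else i)
        (if j = a then b else if j = b then a else j) ∨
      r (if i = a then b else if i = b then a else i)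
        (if j = a then b else if j = b then a else j) ∧ ¬ r i j) ↔
    (i = a ∧ (j ≠ a ∧ j ≠ b ∧ ¬ (r a j ↔ r b j)) ∨ j = a ∧ (i ≠ a ∧ i ≠ b ∧ ¬ (r a i ↔ r b i))) ∨
      (i = b ∧ (j ≠ a ∧ j ≠ b ∧ ¬ (r a j ↔ r b j)) ∨
        j = b ∧ (i ≠ a ∧ i ≠ b ∧ ¬ (r a i ↔ r b i))) := by
  by_cases hia : i = a <;> by_cases hib : i = b <;> by_cases hja : j = a <;>
    by_cases hjb : j = b <;> grind

/-- Adding to an edge set its image under the transposition of `a` and `b` leaves the edges that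
join `a` and `b` to those vertices which are adjacent to exactly one of them. -/
lemma exists_prod_filter_eq_pow_four (hinj : Function.Injective α)
    (hα : ∀ (σ : Equiv.Perm (Fin d)) i, σ • α i = α (σ i))
    {T : Finset (Sym2 (Fin d))} (hT : ∀ e ∈ T, ¬ e.IsDiag) {x : L}
    (hx : ∏ e ∈ T, sqDiff α e = x ^ 4) {a b : Fin d} (hab : a ≠ b) :
    ∃ y, ∏ k ∈ Finset.univ.filter (fun k => k ≠ a ∧ k ≠ b ∧ ¬ (s(a, k) ∈ T ↔ s(b, k) ∈ T)),
      ((α k - α a) * (α k - α b)) ^ 2 = y ^ 4 := by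
  set A := Finset.univ.filter (fun k => k ≠ a ∧ k ≠ b ∧ ¬ (s(a, k) ∈ T ↔ s(b, k) ∈ T)) with hA
  set g := Equiv.swap a b with hg
  set T' := T.image (Sym2.map g) with hT'
  have hinjg : Function.Injective (Sym2.map g) := Sym2.map.injective g.injective
  have hy : ∏ e ∈ T', sqDiff α e = (g • x) ^ 4 := by
    rw [hT', Finset.prod_image hinjg.injOn, ← smul_pow', ← hx, Finset.smul_prod']
    exact Finset.prod_congr rfl fun e _ => (smul_sqDiff hα g e).symm
  have hmem : ∀ i j, s(i, j) ∈ T' ↔ s(g i, g j) ∈ T := by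
    intro i j
    have : s(i, j) = Sym2.map g s(g i, g j) := by
      rw [Sym2.map_mk, hg, Equiv.swap_apply_self, Equiv.swap_apply_self]
    rw [this, hT', hinjg.mem_finset_image]
  have hdiag : ∀ i, s(i, i) ∉ T := fun i hi => hT _ hi rfl
  obtain ⟨z, hz⟩ := exists_prod_symmDiff_sqDiff_eq_pow_four hinj hT hx hy
  refine ⟨z, ?_⟩
  have hunion : symmDiff T T' = A.image (fun k => s(a, k)) ∪ A.image (fun k => s(b, k)) := by
    ext e
    induction e using Sym2.ind with
    | _ i j =>
      rw [Finset.mem_symmDiff, hmem]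
      have himage : ∀ v : Fin d, s(i, j) ∈ A.image (fun k => s(v, k)) ↔
          (i = v ∧ j ∈ A) ∨ (j = v ∧ i ∈ A) := by
        intro v
        simp only [Finset.mem_image, Sym2.eq_iff]
        grind
      rw [Finset.mem_union, himage, himage]
      simp only [hA, Finset.mem_filter, Finset.mem_univ, true_and, hg, Equiv.swap_apply_def]
      exact symm_rel_swap_xor_iff (r := fun i j => s(i, j) ∈ T)
        (fun i j => by rw [Sym2.eq_swap]) hdiag hab i j
  rw [← hz, hunion, Finset.prod_union, Finset.prod_image, Finset.prod_image,
    ← Finset.prod_mul_distrib]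
  · refine Finset.prod_congr rfl fun k _ => ?_
    rw [sqDiff_mk, sqDiff_mk]; ring
  · exact fun k _ l _ h => Sym2.congr_right.1 h
  · exact fun k _ l _ h => Sym2.congr_right.1 h
  · rw [Finset.disjoint_left]
    simp only [Finset.mem_image, hA, Finset.mem_filter, Finset.mem_univ, true_and]
    rintro _ ⟨k, hk, rfl⟩ ⟨l, hl, h⟩
    rw [Sym2.eq_iff] at h
    grind

/-- If the product of the differences along an edge set is a square up to sign, then all vertices
have the same neighbours. -/
lemma mem_iff_mem_of_prod_sqDiff_eq_pow_four (h2 : (2 : L) ≠ 0) (hd6 : 6 ≤ d) (hd : Even d)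
    (hinj : Function.Injective α)
    (hα : ∀ (σ : Equiv.Perm (Fin d)) i, σ • α i = α (σ i))
    (hrig : ∀ (σ : Equiv.Perm (Fin d)) (u v : L), u ^ 4 = v ^ 4 → σ • u * v = σ • v * u)
    {T : Finset (Sym2 (Fin d))} (hT : ∀ e ∈ T, ¬ e.IsDiag) {x : L}
    (hx : ∏ e ∈ T, sqDiff α e = x ^ 4) {a b c : Fin d} (hab : a ≠ b) (hac : a ≠ c)
    (hbc : b ≠ c) : s(a, c) ∈ T ↔ s(b, c) ∈ T := by
  by_contra hcon
  obtain ⟨y, hy⟩ := exists_prod_filter_eq_pow_four hinj hα hT hx hab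
  set A := Finset.univ.filter (fun k => k ≠ a ∧ k ≠ b ∧ ¬ (s(a, k) ∈ T ↔ s(b, k) ∈ T)) with hA
  have hcA : c ∈ A := by simp [hA, hac.symm, hbc.symm, hcon]
  have hAne : ∀ k ∈ A, k ≠ a ∧ k ≠ b := by
    intro k hk
    simp only [hA, Finset.mem_filter] at hk
    exact ⟨hk.2.1, hk.2.2.1⟩
  by_cases hall : ∀ k, k ≠ a → k ≠ b → k ∈ A
  · have hAe : A = (Finset.univ.erase a).erase b := by
      ext k
      simp only [Finset.mem_erase, Finset.mem_univ, and_true]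
      exact ⟨fun hk => (hAne k hk).symm, fun hk => hall k hk.2 hk.1⟩
    apply rootDiffProd_mul_sq_ne_pow_four h2 hd6 hd hinj hα hrig hab
      (y * (α b - α a))
    have ha : rootDiffProd α a = (α b - α a) * ∏ k ∈ A, (α k - α a) := by
      rw [hAe, rootDiffProd, Finset.mul_prod_erase _ (fun k => α k - α a)]
      simp [hab.symm]
    have hb : rootDiffProd α b = (α a - α b) * ∏ k ∈ A, (α k - α b) := by
      rw [hAe, rootDiffProd, Finset.erase_right_comm,
        Finset.mul_prod_erase _ (fun k => α k - α b)]
      simp [hab]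
    rw [mul_pow y, ← hy, ha, hb, Finset.prod_pow, Finset.prod_mul_distrib]
    ring
  · push Not at hall
    obtain ⟨e, hea, heb, heA⟩ := hall
    have hce : c ≠ e := fun h => heA (h ▸ hcA)
    obtain ⟨z, hz⟩ := exists_ne_of_card_lt {a, b, c, e} (by
      have := Finset.card_le_four (a := a) (b := b) (c := c) (d := e); omega)
    simp only [Finset.mem_insert, Finset.mem_singleton, not_or] at hz
    obtain ⟨hza, hzb, hzc, hze⟩ := hz
    set w := ∏ k ∈ A.erase c, ((α k - α a) * (α k - α b)) with hw
    have hw0 : w ≠ 0 := Finset.prod_ne_zero_iff.2 fun k hk => by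
      obtain ⟨h1, h2⟩ := hAne k (Finset.mem_of_mem_erase hk)
      exact mul_ne_zero (sub_ne_zero.2 (hinj.ne h1)) (sub_ne_zero.2 (hinj.ne h2))
    have h1 : ((α c - α a) * (α c - α b)) ^ 2 * w ^ 2 = y ^ 4 := by
      rw [← hy, ← Finset.mul_prod_erase A _ hcA, Finset.prod_pow]
    have hgw : Equiv.swap c e • w = w := by
      rw [hw, Finset.smul_prod']
      refine Finset.prod_congr rfl fun k hk => ?_
      have hkA := Finset.mem_of_mem_erase hk
      rw [smul_mul', smul_sub, smul_sub, hα, hα, hα,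
        Equiv.swap_apply_of_ne_of_ne (Finset.ne_of_mem_erase hk) (ne_of_mem_of_not_mem hkA heA),
        Equiv.swap_apply_of_ne_of_ne hac hea.symm, Equiv.swap_apply_of_ne_of_ne hbc heb.symm]
    have h3 : ((α e - α a) * (α e - α b)) ^ 2 * w ^ 2 = (Equiv.swap c e • y) ^ 4 := by
      rw [← smul_pow', ← h1]
      simp only [smul_mul', smul_sub, smul_pow', hα, hgw, Equiv.swap_apply_left,
        Equiv.swap_apply_of_ne_of_ne hac hea.symm, Equiv.swap_apply_of_ne_of_ne hbc heb.symm]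
    apply four_cycle_sq_ne_pow_four h2 hinj hα hrig hab hac hea.symm (Ne.symm hza) hbc heb.symm
      (Ne.symm hzb) hce (Ne.symm hzc) (Ne.symm hze) (y * (Equiv.swap c e • y) / w)
    rw [div_pow, mul_pow y, ← h1, ← h3, eq_div_iff (pow_ne_zero _ hw0)]
    generalize (α c - α a) * (α c - α b) = y₁, (α e - α a) * (α e - α b) = y₂
    ring

end RigidAction

/-- Elements with equal fourth powers are moved by the same factor: fourth roots of unity are fixed
by every permutation of the roots, as `-1` times the discriminant is not a square in the base
field. -/
lemma smul_mul_eq_of_pow_four_eq {d : ℕ} {K L : Type} [Field K] [Field L] [Algebra K L]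
    [IsGalois K L] [FiniteDimensional K L] {α : Fin d → L}
    (θ : Equiv.Perm (Fin d) →* (L ≃ₐ[K] L)) (hθ : Function.Surjective θ)
    (hα : ∀ σ i, θ σ (α i) = α (σ i))
    (hdisc : ¬ ∃ c : K, (Matrix.vandermonde α).det ^ 2 = algebraMap K L (-(c ^ 2)))
    (σ : Equiv.Perm (Fin d)) {u v : L} (h : u ^ 4 = v ^ 4) : θ σ u * v = θ σ v * u := by
  by_cases hv : v = 0
  · subst hv
    have : u = 0 := by simpa using h
    simp [this]
  obtain ⟨ε, rfl⟩ : ∃ ε, u = ε * v := ⟨u / v, by field_simp⟩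
  suffices hε : θ σ ε = ε by rw [map_mul, hε]; ring
  have hε4 : ε ^ 4 = 1 := by
    rw [mul_pow] at h
    exact mul_right_cancel₀ (pow_ne_zero 4 hv) (by rw [h, one_mul])
  have hε2 : ε ^ 2 = 1 ∨ ε ^ 2 = -1 :=
    sq_eq_sq_iff_eq_or_eq_neg.1 (by rw [← pow_mul, hε4, one_pow])
  rcases hε2 with hε2 | hε2
  · rcases sq_eq_sq_iff_eq_or_eq_neg.1 (hε2.trans (one_pow 2).symm) with h1 | h1 <;> simp [h1]
  have hpm : ∀ τ : Equiv.Perm (Fin d), θ τ ε = ε ∨ θ τ ε = -ε := fun τ =>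
    sq_eq_sq_iff_eq_or_eq_neg.1 (by rw [← map_pow, hε2, map_neg, map_one])
  by_cases hswap : ∀ a b : Fin d, a ≠ b → θ (Equiv.swap a b) ε = ε
  · induction σ using Equiv.Perm.swap_induction_on with
    | one => simp
    | swap_mul f x y hxy ih => rw [map_mul, AlgEquiv.mul_apply, ih, hswap x y hxy]
  exfalso
  push Not at hswap
  obtain ⟨a, b, hab, hne⟩ := hswap
  have hneg : ∀ x y : Fin d, x ≠ y → θ (Equiv.swap x y) ε = -ε := by
    intro x y hxy
    obtain ⟨c, hc⟩ := isConj_iff.1 (Equiv.Perm.isConj_swap hab hxy)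
    rw [mul_inv_eq_iff_eq_mul] at hc
    have h1 : θ c (θ (Equiv.swap a b) ε) = θ (Equiv.swap x y) (θ c ε) := by
      rw [← AlgEquiv.mul_apply, ← AlgEquiv.mul_apply, ← map_mul, ← map_mul, hc]
    rw [(hpm _).resolve_left hne, map_neg] at h1
    rcases hpm c with hc' | hc' <;> rw [hc'] at h1
    · exact h1.symm
    · rw [map_neg] at h1
      linear_combination h1
  let : MulSemiringAction (Equiv.Perm (Fin d)) L := MulSemiringAction.compHom L θ
  have hVneg : ∀ x y : Fin d, x ≠ y →
      θ (Equiv.swap x y) (Matrix.vandermonde α).det = -(Matrix.vandermonde α).det :=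
    fun x y hxy => swap_smul_det_vandermonde (L := L) hα hxy
  have hfix : ∀ τ, θ τ (ε * (Matrix.vandermonde α).det) = ε * (Matrix.vandermonde α).det := by
    intro τ
    induction τ using Equiv.Perm.swap_induction_on with
    | one => simp
    | swap_mul f x y hxy ih =>
      rw [map_mul θ, AlgEquiv.mul_apply, ih, map_mul, hneg x y hxy, hVneg x y hxy, neg_mul_neg]
  obtain ⟨c, hc⟩ := (IsGalois.mem_range_algebraMap_iff_fixed (F := K)
    (ε * (Matrix.vandermonde α).det)).2 (fun g => by
      obtain ⟨τ, rfl⟩ := hθ g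
      exact hfix τ)
  refine hdisc ⟨c, ?_⟩
  rw [map_neg, map_pow, hc, mul_pow, hε2]
  ring

/-- If the Galois group realizes every permutation of the roots, it is the symmetric group. -/
lemma exists_perm_hom_surjective {d : ℕ} {K L : Type} [Field K] [Field L] [Algebra K L]
    {f : Polynomial K} (hdeg : f.natDegree = d) (hsep : f.Separable)
    (hsplit : Polynomial.IsSplittingField K L f) {α : Fin d → L} (hinj : Function.Injective α)
    (hroots : ∀ i, Polynomial.aeval (α i) f = 0)
    (hgal : ∀ σ : Equiv.Perm (Fin d), ∃ τ : L ≃ₐ[K] L, ∀ i, τ (α i) = α (σ i)) :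
    ∃ θ : Equiv.Perm (Fin d) →* (L ≃ₐ[K] L), Function.Surjective θ ∧
      ∀ σ i, θ σ (α i) = α (σ i) := by
  classical
  have hroot : ∀ x : L, x ∈ f.rootSet L → ∃ i, α i = x := by
    have hsub : Finset.univ.image α ⊆ (f.aroots L).toFinset := by
      intro x hx
      obtain ⟨i, -, rfl⟩ := Finset.mem_image.1 hx
      rw [Multiset.mem_toFinset, mem_aroots]
      exact ⟨hsep.ne_zero, hroots i⟩
    have hcard : (f.aroots L).toFinset.card ≤ (Finset.univ.image α).card := by
      rw [Finset.card_image_of_injective _ hinj, Finset.card_univ, Fintype.card_fin, ← hdeg,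
        ← natDegree_map (algebraMap K L)]
      exact (Multiset.toFinset_card_le _).trans (card_roots' _)
    intro x hx
    have hx' : x ∈ (f.aroots L).toFinset := by simpa [rootSet] using hx
    rw [← Finset.eq_of_subset_of_card_le hsub hcard] at hx'
    obtain ⟨i, -, hi⟩ := Finset.mem_image.1 hx'
    exact ⟨i, hi⟩
  have hext : ∀ g h : L ≃ₐ[K] L, (∀ i, g (α i) = h (α i)) → g = h := by
    intro g h hgh
    have : (g : L →ₐ[K] L) = h := by
      refine AlgHom.ext_of_adjoin_eq_top hsplit.adjoin_rootSet' fun x hx => ?_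
      obtain ⟨i, rfl⟩ := hroot x hx
      exact hgh i
    exact AlgEquiv.ext fun x => DFunLike.congr_fun this x
  choose θ hθ using hgal
  refine ⟨{ toFun := θ, map_one' := ?_, map_mul' := ?_ }, ?_, hθ⟩
  · exact hext _ _ fun i => by rw [hθ]; rfl
  · intro σ τ
    exact hext _ _ fun i => by rw [hθ, AlgEquiv.mul_apply, hθ, hθ]; rfl
  · intro g
    have hg : ∀ i, ∃ j, α j = g (α i) := fun i => hroot _ (by
      rw [mem_rootSet]
      exact ⟨hsep.ne_zero, by rw [aeval_algHom_apply, hroots, map_zero]⟩)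
    choose p hp using hg
    have hpinj : Function.Injective p := fun i j hij =>
      hinj (g.injective (by rw [← hp, ← hp, hij]))
    refine ⟨Equiv.ofBijective p (Finite.injective_iff_bijective.1 hpinj), ?_⟩
    exact hext _ _ fun i => by
      rw [← hp]
      exact hθ _ i

/-- Let `K` be a field of characteristic different from 2, `f ∈ K[x]` a
separable polynomial of even degree `d ≥ 6` whose Galois group, acting on its `d` roots
`α₁, …, α_d` in its splitting field `L`, is the full symmetric group `S_d`.  Assume the
discriminant `Δ = ∏_{i<j} (α_j − α_i)²` does not lie in `−K²`.  Then for every nonempty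
set `S` of pairs `(i,j)` with `i < j`, the product `∏_{(i,j) ∈ S} (α_j − α_i)` is not a
square in `L`; equivalently, the classes of the `α_j − α_i` are linearly independent in
the `𝔽₂`-vector space `L^×/(L^×)²`. -/
theorem stmt7 (K L : Type) [Field K] [Field L] [Algebra K L]
    (hchar : (2 : K) ≠ 0)
    (f : Polynomial K) (d : ℕ) (hd6 : 6 ≤ d) (hdeven : Even d)
    (hdeg : f.natDegree = d) (hsep : f.Separable)
    (hsplit : Polynomial.IsSplittingField K L f)
    (α : Fin d → L) (hinj : Function.Injective α)
    (hroots : ∀ i, Polynomial.aeval (α i) f = 0)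
    (hgal : ∀ σ : Equiv.Perm (Fin d), ∃ τ : L ≃ₐ[K] L, ∀ i, τ (α i) = α (σ i))
    (hdisc : ¬ ∃ c : K,
      (∏ p ∈ Finset.univ.filter (fun p : Fin d × Fin d => p.1 < p.2), (α p.2 - α p.1)) ^ 2 =
        algebraMap K L (-(c ^ 2))) :
    ∀ S : Finset (Fin d × Fin d), S.Nonempty → (∀ p ∈ S, p.1 < p.2) →
      ¬ ∃ β : L, ∏ p ∈ S, (α p.2 - α p.1) = β ^ 2 := by
  rintro S ⟨⟨p, q⟩, hpq⟩ hS ⟨β, hβ⟩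
  have hlt : p < q := hS _ hpq
  obtain ⟨θ, hθ, hα⟩ := exists_perm_hom_surjective hdeg hsep hsplit hinj hroots hgal
  have : IsGalois K L := IsGalois.of_separable_splitting_field hsep
  have : FiniteDimensional K L := Polynomial.IsSplittingField.finiteDimensional L f
  have hV : ∏ p ∈ Finset.univ.filter (fun p : Fin d × Fin d => p.1 < p.2), (α p.2 - α p.1) =
      (Matrix.vandermonde α).det := by
    rw [Matrix.det_vandermonde, ← Finset.univ_product_univ, Finset.prod_filter,
      Finset.prod_product]
    refine Finset.prod_congr rfl fun i _ => ?_
    rw [← Finset.prod_filter, Finset.filter_lt_eq_Ioi]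
  rw [hV] at hdisc
  let : MulSemiringAction (Equiv.Perm (Fin d)) L := MulSemiringAction.compHom L θ
  have hrig : ∀ (σ : Equiv.Perm (Fin d)) (u v : L), u ^ 4 = v ^ 4 → σ • u * v = σ • v * u :=
    fun σ u v h => smul_mul_eq_of_pow_four_eq θ hθ hα hdisc σ h
  have h2 : (2 : L) ≠ 0 := by
    rw [← map_ofNat (algebraMap K L) 2]
    exact (_root_.map_ne_zero _).2 hchar
  set T : Finset (Sym2 (Fin d)) := S.image Sym2.mk.uncurry with hTdef
  have hmem : ∀ i j : Fin d, i < j → (s(i, j) ∈ T ↔ (i, j) ∈ S) := by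
    intro i j hij
    rw [hTdef, Finset.mem_image]
    constructor
    · rintro ⟨⟨k, l⟩, hkl, h⟩
      rcases Sym2.eq_iff.1 h with ⟨rfl, rfl⟩ | ⟨rfl, rfl⟩
      · exact hkl
      · exact absurd (hS _ hkl) hij.asymm
    · exact fun h => ⟨_, h, rfl⟩
  have hT : ∀ e ∈ T, ¬ e.IsDiag := by
    intro e he
    obtain ⟨⟨k, l⟩, hkl, rfl⟩ := Finset.mem_image.1 he
    exact (hS _ hkl).ne
  have hx : ∏ e ∈ T, sqDiff α e = β ^ 4 := by
    rw [hTdef, Finset.prod_image]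
    · rw [show β ^ 4 = (β ^ 2) ^ 2 by ring, ← hβ, ← Finset.prod_pow]
      refine Finset.prod_congr rfl fun e _ => ?_
      change (α e.1 - α e.2) ^ 2 = _
      ring
    · rintro ⟨i, j⟩ hij ⟨k, l⟩ hkl h
      rcases Sym2.eq_iff.1 h with ⟨rfl, rfl⟩ | ⟨rfl, rfl⟩
      · rfl
      · exact absurd (hS _ hij) (hS _ hkl).asymm
  have hnbr : ∀ {a b c : Fin d}, a ≠ b → a ≠ c → b ≠ c → (s(a, c) ∈ T ↔ s(b, c) ∈ T) :=
    mem_iff_mem_of_prod_sqDiff_eq_pow_four h2 hd6 hdeven hinj hα hrig hT hx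
  have hp : ∀ k, k ≠ p → s(k, p) ∈ T := by
    intro k hk
    by_cases hkq : k = q
    · rw [hkq, Sym2.eq_swap]
      exact (hmem p q hlt).2 hpq
    · rw [hnbr hkq hk hlt.ne', Sym2.eq_swap]
      exact (hmem p q hlt).2 hpq
  have hall : ∀ i j, i ≠ j → s(i, j) ∈ T := by
    intro i j hij
    by_cases hjp : j = p
    · exact hjp ▸ hp i (hjp ▸ hij)
    by_cases hip : i = p
    · rw [hip, Sym2.eq_swap]
      exact hp j hjp
    · rw [hnbr hip hij (Ne.symm hjp), Sym2.eq_swap]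
      exact hp j hjp
  have hSuniv : S = Finset.univ.filter (fun p : Fin d × Fin d => p.1 < p.2) := by
    ext ⟨i, j⟩
    simp only [Finset.mem_filter, Finset.mem_univ, true_and]
    exact ⟨fun h => hS _ h, fun h => (hmem i j h).1 (hall i j h.ne)⟩
  refine det_vandermonde_sq_ne_pow_four h2 hinj hα hrig hlt.ne β ?_
  rw [← hV, ← hSuniv, hβ]
  ring
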